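/- Let λ be an anti-dominant weight and σ_λ = ⋃_{w ∈ W_λ} w·C. Then λ lies in the (topological) interior of σ_λ. -/

import Mathlib

open scoped RealInnerProductSpace

/-- The (orthogonal) reflection in the hyperplane orthogonal to `a`. -/
noncomputable def reflAt {V : Type*} [NormedAddCommGroup V] [InnerProductSpace ℝ V]
    (a : V) : V → V :=
  fun v => v - (2 * ⟪v, a⟫ / ⟪a, a⟫) • a

/-- Base data of a root system in a Euclidean space: the simple roots `α` (a basis of `V`)
and the fundamental weights `ω`, characterized by `⟨ω i, (α j)^∨⟩ = δ_ij`. -/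
structure RootSystemBase (n : ℕ) (V : Type*) [NormedAddCommGroup V]
    [InnerProductSpace ℝ V] where
  α : Fin n → V
  ω : Fin n → V
  α_ne : ∀ i, α i ≠ 0
  indep : LinearIndependent ℝ α
  span_top : Submodule.span ℝ (Set.range α) = ⊤
  dual : ∀ i j, 2 * ⟪ω i, α j⟫ / ⟪α j, α j⟫ = if i = j then 1 else 0

namespace RootSystemBase

variable {n : ℕ} {V : Type*} [NormedAddCommGroup V] [InnerProductSpace ℝ V]

/-- The anti-dominant Weyl chamber `C`. -/
def C (B : RootSystemBase n V) : Set V := {v | ∀ i, ⟪v, B.α i⟫ ≤ 0}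

/-- `W` is the Weyl group of the root system: the group generated by the simple
reflections `s_{α_i}`. -/
def IsWeylGroup (B : RootSystemBase n V) (W : Subgroup (V ≃ₗ[ℝ] V)) : Prop :=
  W = Subgroup.closure {g : V ≃ₗ[ℝ] V | ∃ i, ∀ v, g v = reflAt (B.α i) v}

/-- The stabilizer `W_x = {w ∈ W : w·x = x}`. -/
def stab (W : Subgroup (V ≃ₗ[ℝ] V)) (x : V) : Set (V ≃ₗ[ℝ] V) :=
  {w | w ∈ W ∧ w x = x}

/-- `σ_λ = ⋃_{w ∈ W_λ} w·C`. -/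
def sigmaCone (B : RootSystemBase n V) (W : Subgroup (V ≃ₗ[ℝ] V)) (l : V) : Set V :=
  ⋃ w ∈ stab W l, ⇑w '' B.C

/-- `γ_I = ℝ⁺⟨-ω_i : i ∈ I⟩`, the cone generated by the negatives of the fundamental
weights indexed by `I`. -/
def gammaCone (B : RootSystemBase n V) (I : Set (Fin n)) : Set V :=
  {v | ∃ c : Fin n → ℝ, (∀ i, 0 ≤ c i) ∧ (∀ i, i ∉ I → c i = 0) ∧
    v = ∑ i, c i • (-(B.ω i))}

/-- `F` is a face of the convex cone `σ`. -/
def IsFace (σ F : Set V) : Prop :=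
  F ⊆ σ ∧ Convex ℝ F ∧ ∀ x ∈ σ, ∀ y ∈ σ, x + y ∈ F → x ∈ F ∧ y ∈ F

/-- The ray generated by `v`. -/
def rayOf (v : V) : Set V := {x | ∃ c : ℝ, 0 ≤ c ∧ x = c • v}

/-- The set of primitive lattice generators of the rays (one-dimensional faces) of the
cone `σ`, relative to the lattice `Λ`. -/
def Prim (Λ : AddSubgroup V) (σ : Set V) : Set V :=
  {v | v ∈ Λ ∧ v ≠ 0 ∧ IsFace σ (rayOf v) ∧
    ∀ u ∈ Λ, u ∈ rayOf v → ∃ k : ℕ, u = k • v}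

end RootSystemBase

namespace WeylAux

variable {V : Type*} [NormedAddCommGroup V] [InnerProductSpace ℝ V]

/-- The reflection as a linear isometry equivalence. -/
noncomputable def sA (a : V) : V ≃ₗᵢ[ℝ] V := (ℝ ∙ a)ᗮ.reflection

lemma sA_apply (a v : V) : sA a v = reflAt a v := by
  unfold sA reflAt
  rw [Submodule.reflection_orthogonal_apply, Submodule.reflection_singleton_apply,
    real_inner_self_eq_norm_sq, real_inner_comm, neg_sub, two_smul, ← add_smul]
  congr 2
  simp only [RCLike.ofReal_real_eq_id, id]
  ring

lemma reflAt_map (g : V ≃ₗᵢ[ℝ] V) (y v : V) :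
    reflAt (g y) v = g (reflAt y (g⁻¹ v)) := by
  have h : v = g (g⁻¹ v) := (g.apply_symm_apply v).symm
  conv_lhs => rw [h]
  unfold reflAt
  rw [map_sub, map_smul, g.inner_map_map, g.inner_map_map]

lemma inner_inv (g : V ≃ₗᵢ[ℝ] V) (x y : V) : ⟪g x, y⟫ = ⟪x, g⁻¹ y⟫ := by
  have h : y = g (g⁻¹ y) := (g.apply_symm_apply y).symm
  conv_lhs => rw [h]
  rw [g.inner_map_map]

/-- `u` lies in the closure of the orbit of `v`. -/
def Rel (G : Subgroup (V ≃ₗᵢ[ℝ] V)) (v u : V) : Prop := ∀ ε > 0, ∃ g ∈ G, ‖g v - u‖ < ε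

variable {G : Subgroup (V ≃ₗᵢ[ℝ] V)}

lemma rel_mem {g : V ≃ₗᵢ[ℝ] V} (hg : g ∈ G) (v : V) : Rel G v (g v) := by
  intro ε hε
  exact ⟨g, hg, by simpa using hε⟩

lemma rel_refl (v : V) : Rel G v v := by
  intro ε hε
  exact ⟨1, G.one_mem, by simpa using hε⟩

lemma rel_symm {v u : V} (h : Rel G v u) : Rel G u v := by
  intro ε hε
  obtain ⟨g, hg, h1⟩ := h ε hε
  refine ⟨g⁻¹, G.inv_mem hg, ?_⟩
  rw [← g.norm_map, map_sub, norm_sub_rev]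
  have : g (g⁻¹ u) = u := g.apply_symm_apply u
  rwa [this]

lemma rel_trans {v u w : V} (h : Rel G v u) (h' : Rel G u w) : Rel G v w := by
  intro ε hε
  obtain ⟨g, hg, h1⟩ := h (ε / 2) (by positivity)
  obtain ⟨k, hk, h2⟩ := h' (ε / 2) (by positivity)
  refine ⟨k * g, G.mul_mem hk hg, ?_⟩
  have e : (k * g) v - w = k (g v - u) + (k u - w) := by
    rw [map_sub, LinearIsometryEquiv.coe_mul, Function.comp]; abel
  rw [e]
  calc _ ≤ ‖k (g v - u)‖ + ‖k u - w‖ := norm_add_le _ _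
    _ < ε := by rw [k.norm_map]; linarith

lemma rel_closed (v : V) : IsClosed {u | Rel G v u} := by
  rw [← isSeqClosed_iff_isClosed]
  intro x u hx hu ε hε
  rw [Metric.tendsto_atTop] at hu
  obtain ⟨N, hN⟩ := hu (ε / 2) (by positivity)
  obtain ⟨g, hg, h1⟩ := hx N (ε / 2) (by positivity)
  refine ⟨g, hg, ?_⟩
  have := hN N le_rfl
  rw [dist_eq_norm] at this
  calc _ = ‖(g v - x N) + (x N - u)‖ := by congr 1; abel
    _ ≤ _ := norm_add_le _ _
    _ < ε := by linarith

/-- Vectors whose reflection preserves orbit closures. -/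
def R (G : Subgroup (V ≃ₗᵢ[ℝ] V)) : Set V := {x | ∀ v, Rel G v (reflAt x v)}

lemma zero_mem_R : (0 : V) ∈ R G := by
  intro v
  simpa [reflAt] using rel_refl v

lemma R_closed : IsClosed (R G) := by
  rw [← isSeqClosed_iff_isClosed]
  intro x a hx ha
  by_cases h0 : a = 0
  · rw [h0]; exact zero_mem_R
  intro v
  refine (rel_closed (G := G) v).mem_of_tendsto (b := Filter.atTop)
    (f := fun n => reflAt (x n) v) ?_ (Filter.Eventually.of_forall fun n => hx n v)
  unfold reflAt
  have hi : ⟪a, a⟫ ≠ 0 := by simpa using h0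
  have h1 : Filter.Tendsto (fun n => ⟪v, x n⟫) Filter.atTop (nhds ⟪v, a⟫) :=
    tendsto_const_nhds.inner ha
  have h2 : Filter.Tendsto (fun n => ⟪x n, x n⟫) Filter.atTop (nhds ⟪a, a⟫) := ha.inner ha
  exact tendsto_const_nhds.sub (((h1.const_mul 2).div h2 hi).smul ha)

lemma R_smul {x : V} (hx : x ∈ R G) (c : ℝ) : c • x ∈ R G := by
  by_cases hc : c = 0
  · rw [hc, zero_smul]; exact zero_mem_R
  by_cases h0 : x = 0
  · rw [h0, smul_zero]; exact zero_mem_R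
  intro v
  have : reflAt (c • x) v = reflAt x v := by
    unfold reflAt
    have hi : ⟪x, x⟫ ≠ 0 := by simpa using h0
    rw [inner_smul_right, inner_smul_left, inner_smul_right, smul_smul]
    congr 2
    simp only [conj_trivial]
    field_simp
  rw [this]; exact hx v

lemma R_map {x : V} (hx : x ∈ R G) (h : V ≃ₗᵢ[ℝ] V) (hh : ∀ v, Rel G v (h v)) : h x ∈ R G := by
  intro v
  rw [reflAt_map]
  have e : Rel G v (h⁻¹ v) := by
    have := rel_symm (hh (h⁻¹ v))
    rwa [show h (h⁻¹ v) = v from h.apply_symm_apply v] at this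
  exact rel_trans e (rel_trans (hx _) (hh _))

lemma R_refl {x y : V} (hx : x ∈ R G) (hy : y ∈ R G) : reflAt x y ∈ R G := by
  rw [← sA_apply]
  exact R_map hy _ fun v => by rw [sA_apply]; exact hx v

/-- Point on a circle. -/
noncomputable def circ (a e : V) (φ : ℝ) : V := Real.cos φ • a + Real.sin φ • e

lemma circ_step {a e : V} (ha : ‖a‖ = 1) (he : ‖e‖ = 1) (hae : ⟪a, e⟫ = 0) {φ ψ : ℝ}
    (h1 : circ a e φ ∈ R G) (h2 : circ a e ψ ∈ R G) : circ a e (2 * φ - ψ) ∈ R G := by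
  have haa : ⟪a, a⟫ = 1 := by rw [real_inner_self_eq_norm_sq, ha]; norm_num
  have hee : ⟪e, e⟫ = 1 := by rw [real_inner_self_eq_norm_sq, he]; norm_num
  have hea : ⟪e, a⟫ = 0 := by rw [real_inner_comm]; exact hae
  have h := R_smul (R_refl h1 h2) (-1)
  convert h using 1
  have e1 : ⟪circ a e ψ, circ a e φ⟫ = Real.cos (φ - ψ) := by
    simp only [circ, inner_add_left, inner_add_right, inner_smul_left, inner_smul_right, haa, hee,
      hae, hea, conj_trivial]
    rw [Real.cos_sub]; ring
  have e2 : ⟪circ a e φ, circ a e φ⟫ = 1 := by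
    simp only [circ, inner_add_left, inner_add_right, inner_smul_left, inner_smul_right, haa, hee,
      hae, hea, conj_trivial]
    nlinarith [Real.sin_sq_add_cos_sq φ]
  unfold reflAt
  rw [e1, e2, div_one]
  have c1 : Real.cos (2 * φ - ψ) = 2 * Real.cos (φ - ψ) * Real.cos φ - Real.cos ψ := by
    rw [Real.cos_sub, Real.cos_sub, Real.cos_two_mul, Real.sin_two_mul]
    ring
  have c2 : Real.sin (2 * φ - ψ) = 2 * Real.cos (φ - ψ) * Real.sin φ - Real.sin ψ := by
    rw [Real.sin_sub, Real.cos_sub, Real.cos_two_mul, Real.sin_two_mul]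
    have := Real.sin_sq_add_cos_sq φ
    have h3 : Real.cos φ ^ 2 = 1 - Real.sin φ ^ 2 := by linarith
    linear_combination (-2 * Real.sin ψ) * this
  simp only [circ] at *
  rw [c1, c2]
  module

lemma circ_mul {a e : V} (ha : ‖a‖ = 1) (he : ‖e‖ = 1) (hae : ⟪a, e⟫ = 0) {θ : ℝ}
    (h0 : a ∈ R G) (h1 : circ a e θ ∈ R G) (k : ℕ) : circ a e (k * θ) ∈ R G := by
  have h0' : circ a e 0 ∈ R G := by simpa [circ] using h0
  have key : ∀ k : ℕ, circ a e (k * θ) ∈ R G ∧ circ a e ((k + 1 : ℕ) * θ) ∈ R G := by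
    intro k
    induction k with
    | zero => exact ⟨by simpa using h0', by simpa using h1⟩
    | succ k ih =>
      refine ⟨ih.2, ?_⟩
      have := circ_step ha he hae ih.2 ih.1
      convert this using 2
      push_cast; ring
  exact (key k).1

lemma circ_mul_int {a e : V} (ha : ‖a‖ = 1) (he : ‖e‖ = 1) (hae : ⟪a, e⟫ = 0) {θ : ℝ}
    (h0 : a ∈ R G) (h1 : circ a e θ ∈ R G) (k : ℤ) : circ a e (k * θ) ∈ R G := by
  have h0' : circ a e 0 ∈ R G := by simpa [circ] using h0
  obtain ⟨m, rfl | rfl⟩ := k.eq_nat_or_neg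
  · exact_mod_cast circ_mul ha he hae h0 h1 m
  · have := circ_step ha he hae h0' (circ_mul ha he hae h0 h1 m)
    convert this using 2
    push_cast; ring

lemma circ_continuous (a e : V) : Continuous (circ a e) := by
  unfold circ; fun_prop

lemma circ_irr {a e : V} (ha : ‖a‖ = 1) (he : ‖e‖ = 1) (hae : ⟪a, e⟫ = 0) {θ : ℝ}
    (h0 : a ∈ R G) (h1 : circ a e θ ∈ R G) (hθ : Irrational (θ / (2 * Real.pi))) (φ : ℝ) :
    circ a e φ ∈ R G := by
  have hd := dense_addSubgroupClosure_pair_iff.2 hθ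
  have hc : IsClosed (circ a e ⁻¹' R G) := R_closed.preimage (circ_continuous a e)
  have hs : (AddSubgroup.closure {θ, 2 * Real.pi} : Set ℝ) ⊆ circ a e ⁻¹' R G := by
    intro z hz
    obtain ⟨m, n, rfl⟩ := AddSubgroup.mem_closure_pair.1 hz
    have := circ_mul_int ha he hae h0 h1 m
    simp only [Set.mem_preimage, zsmul_eq_mul]
    convert this using 1
    simp [circ, Real.cos_add_int_mul_two_pi, Real.sin_add_int_mul_two_pi]
  have := hd.closure_eq ▸ (closure_minimal hs hc)
  exact this (Set.mem_univ φ)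

/-- A full circle gives the full plane. -/
lemma plane_of_circ {a e : V} (h : ∀ φ, circ a e φ ∈ R G) (x y : ℝ) : x • a + y • e ∈ R G := by
  have := R_smul (h (Complex.arg ⟨x, y⟩)) ‖(⟨x, y⟩ : ℂ)‖
  convert this using 1
  have h1 := Complex.norm_mul_cos_arg ⟨x, y⟩
  have h2 := Complex.norm_mul_sin_arg ⟨x, y⟩
  simp only at h1 h2
  rw [circ, smul_add, smul_smul, smul_smul, h1, h2]

open InnerProductGeometry in
lemma polar {a b : V} (ha : ‖a‖ = 1) (hb : b ≠ 0) (hs : Real.sin (angle a b) ≠ 0) :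
    ∃ e : V, ‖e‖ = 1 ∧ ⟪a, e⟫ = 0 ∧ b = ‖b‖ • circ a e (angle a b) := by
  have hb' : ‖b‖ ≠ 0 := norm_ne_zero_iff.2 hb
  have hc : ⟪a, b⟫ = Real.cos (angle a b) * ‖b‖ := by
    rw [cos_angle, ha]; field_simp
  have haa : ⟪a, a⟫ = 1 := by rw [real_inner_self_eq_norm_sq, ha]; norm_num
  have hba : ⟪b, a⟫ = Real.cos (angle a b) * ‖b‖ := by rw [real_inner_comm, hc]
  have hbb : ⟪b, b⟫ = ‖b‖ ^ 2 := real_inner_self_eq_norm_sq b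
  set θ := angle a b
  refine ⟨(Real.sin θ)⁻¹ • (‖b‖⁻¹ • b - Real.cos θ • a), ?_, ?_, ?_⟩
  · have : ‖(Real.sin θ)⁻¹ • (‖b‖⁻¹ • b - Real.cos θ • a)‖ ^ 2 = 1 := by
      rw [← real_inner_self_eq_norm_sq]
      simp only [inner_sub_left, inner_sub_right, inner_smul_left, inner_smul_right, haa, hba, hbb,
        hc, conj_trivial]
      field_simp
      linarith [Real.sin_sq_add_cos_sq θ]
    exact (pow_eq_one_iff_of_nonneg (norm_nonneg _) two_ne_zero).1 this
  · simp only [inner_sub_right, inner_smul_right, haa, hc]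
    field_simp
    simp
  · rw [circ, smul_smul, mul_inv_cancel₀ hs, one_smul, add_sub_cancel, smul_smul,
      mul_inv_cancel₀ hb', one_smul]

open InnerProductGeometry in
lemma plane_irr {a u : V} (ha : ‖a‖ = 1) (hu : u ≠ 0) (haR : a ∈ R G) (huR : u ∈ R G)
    (hirr : Irrational (angle a u / (2 * Real.pi))) (t : ℝ) : u + t • a ∈ R G := by
  have hs : Real.sin (angle a u) ≠ 0 := by
    intro h
    obtain ⟨m, hm⟩ := Real.sin_eq_zero_iff.1 h
    apply hirr
    refine ⟨(m : ℚ) / 2, ?_⟩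
    rw [← hm]
    push_cast
    field_simp
  obtain ⟨e, he, hae, hue⟩ := polar ha hu hs
  have hu' : ‖u‖ ≠ 0 := norm_ne_zero_iff.2 hu
  have hc : circ a e (angle a u) ∈ R G := by
    have := R_smul huR ‖u‖⁻¹
    rw [hue, smul_smul, norm_smul, norm_norm] at this
    have h1 : ‖circ a e (angle a u)‖ = 1 := by
      have h2 := congrArg norm hue
      rw [norm_smul, norm_norm] at h2
      field_simp at h2
      exact h2.symm
    rwa [h1, mul_one, inv_mul_cancel₀ hu', one_smul] at this
  have := plane_of_circ (circ_irr ha he hae haR hc hirr)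
    (‖u‖ * Real.cos (angle a u) + t) (‖u‖ * Real.sin (angle a u))
  convert this using 1
  conv_lhs => rw [hue]
  rw [circ]
  module

open InnerProductGeometry in
lemma exists_irr {a u e : V} (ha : ‖a‖ = 1) (hau : ⟪a, u⟫ ≠ 0) (hae : ⟪a, e⟫ = 0) (he : e ≠ 0)
    {δ : ℝ} (hδ : 0 < δ) :
    ∃ s : ℝ, |s| ≤ δ ∧ Irrational (angle a (u + s • e) / (2 * Real.pi)) := by
  have ha0 : a ≠ 0 := by intro h; rw [h] at ha; simp at ha
  have hin : ∀ s : ℝ, ⟪a, u + s • e⟫ = ⟪a, u⟫ := by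
    intro s; rw [inner_add_right, inner_smul_right, hae]; ring
  have hne : ∀ s : ℝ, u + s • e ≠ 0 := by
    intro s h
    have := hin s
    rw [h, inner_zero_right] at this
    exact hau this.symm
  set f : ℝ → ℝ := fun s => angle a (u + s • e) / (2 * Real.pi) with hf
  have hcont : Continuous f := by
    rw [continuous_iff_continuousAt]
    intro s
    have h1 : ContinuousAt (fun y : V × V => angle y.1 y.2) (a, u + s • e) :=
      continuousAt_angle ha0 (hne s)
    have h2 : ContinuousAt (fun s : ℝ => (a, u + s • e)) s := by fun_prop
    exact (ContinuousAt.comp (f := fun s : ℝ => (a, u + s • e)) h1 h2).div_const _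
  have hpi := Real.pi_pos
  have hnorm : ∀ s t : ℝ, f s = f t → ‖u + s • e‖ ^ 2 = ‖u + t • e‖ ^ 2 := by
    intro s t h
    have h1 : angle a (u + s • e) = angle a (u + t • e) := by
      simp only [hf] at h
      field_simp at h
      exact h
    have h2 := congrArg Real.cos h1
    rw [cos_angle, cos_angle, hin, hin, ha, one_mul, one_mul] at h2
    have h3 := norm_ne_zero_iff.2 (hne s)
    have h4 := norm_ne_zero_iff.2 (hne t)
    field_simp at h2
    rw [h2]
  have hex : ∀ s : ℝ, ‖u + s • e‖ ^ 2 = ‖u‖ ^ 2 + 2 * s * ⟪u, e⟫ + s ^ 2 * ‖e‖ ^ 2 := by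
    intro s
    rw [norm_add_sq_real, inner_smul_right, norm_smul, mul_pow, Real.norm_eq_abs, sq_abs]
    ring
  have hepos : 0 < ‖e‖ ^ 2 := by have := norm_pos_iff.2 he; positivity
  have hdiff : ∃ s ∈ Set.Icc 0 δ, f s ≠ f 0 := by
    by_contra! hcon
    have h1 := hnorm _ _ (hcon δ ⟨hδ.le, le_rfl⟩)
    have h2 := hnorm _ _ (hcon (δ / 2) ⟨by linarith, by linarith⟩)
    rw [hex, hex] at h1 h2
    have : δ ^ 2 * ‖e‖ ^ 2 = 0 := by linarith
    have : 0 < δ ^ 2 * ‖e‖ ^ 2 := by positivity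
    linarith
  obtain ⟨s, hs, hsf⟩ := hdiff
  have hirr : ∃ r, Irrational r ∧ r ∈ Set.uIcc (f 0) (f s) := by
    rcases lt_or_gt_of_ne hsf with h | h
    · obtain ⟨r, hr, h1, h2⟩ := exists_irrational_btwn h
      exact ⟨r, hr, by rw [Set.uIcc_of_ge h.le]; exact ⟨h1.le, h2.le⟩⟩
    · obtain ⟨r, hr, h1, h2⟩ := exists_irrational_btwn h
      exact ⟨r, hr, by rw [Set.uIcc_of_le h.le]; exact ⟨h1.le, h2.le⟩⟩
  obtain ⟨r, hr, hr2⟩ := hirr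
  obtain ⟨t, ht, htr⟩ := intermediate_value_uIcc hcont.continuousOn hr2
  rw [Set.uIcc_of_le hs.1] at ht
  refine ⟨t, ?_, ?_⟩
  · rw [abs_of_nonneg ht.1]; exact ht.2.trans hs.2
  · change Irrational (f t); rw [htr]; exact hr

lemma R_limit {x y : V} (h : ∀ δ > 0, ∃ s : ℝ, |s| ≤ δ ∧ x + s • y ∈ R G) : x ∈ R G := by
  choose! s hs hR using h
  have hpos : ∀ n : ℕ, (0 : ℝ) < 1 / ((n : ℝ) + 1) := fun n => by positivity
  have ht : Filter.Tendsto (fun n : ℕ => s (1 / ((n : ℝ) + 1))) Filter.atTop (nhds 0) :=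
    squeeze_zero_norm (fun n => hs _ (hpos n)) tendsto_one_div_add_atTop_nhds_zero_nat
  have h2 : Filter.Tendsto (fun n : ℕ => x + s (1 / ((n : ℝ) + 1)) • y) Filter.atTop
      (nhds (x + (0 : ℝ) • y)) := tendsto_const_nhds.add (ht.smul_const y)
  rw [zero_smul, add_zero] at h2
  exact R_closed.mem_of_tendsto h2 (Filter.Eventually.of_forall fun n => hR _ (hpos n))

lemma step {U : Submodule ℝ V} (hU : (U : Set V) ⊆ R G) {a e u₀ : V} (ha : ‖a‖ = 1)
    (haR : a ∈ R G) (heU : e ∈ U) (he : e ≠ 0) (hae : ⟪a, e⟫ = 0)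
    (hu₀ : u₀ ∈ U) (hau₀ : ⟪a, u₀⟫ ≠ 0) {u : V} (hu : u ∈ U) (t : ℝ) : u + t • a ∈ R G := by
  have key : ∀ u ∈ U, ⟪a, u⟫ ≠ 0 → u + t • a ∈ R G := by
    intro u hu hau
    apply R_limit (y := e)
    intro δ hδ
    obtain ⟨s, hs, hirr⟩ := exists_irr ha hau hae he hδ
    refine ⟨s, hs, ?_⟩
    have hmem : u + s • e ∈ U := U.add_mem hu (U.smul_mem s heU)
    have hne : u + s • e ≠ 0 := by
      intro h
      have h2 : ⟪a, u + s • e⟫ = 0 := by rw [h, inner_zero_right]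
      rw [inner_add_right, inner_smul_right, hae] at h2
      apply hau; linarith
    have := plane_irr ha hne haR (hU hmem) hirr t
    convert this using 1
    abel
  by_cases hau : ⟪a, u⟫ = 0
  · apply R_limit (y := u₀)
    intro δ hδ
    refine ⟨δ, by rw [abs_of_pos hδ], ?_⟩
    have := key (u + δ • u₀) (U.add_mem hu (U.smul_mem _ hu₀)) (by
      rw [inner_add_right, inner_smul_right, hau, zero_add]
      exact mul_ne_zero hδ.ne' hau₀)
    convert this using 1
    abel
  · exact key u hu hau

open InnerProductGeometry Filter in
lemma base [FiniteDimensional ℝ V] {Φ : Set V} (hΦ : Φ.Infinite) (hR : Φ ⊆ R G) {r : ℝ}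
    (hr : ∀ x ∈ Φ, ‖x‖ = r) :
    ∃ a e : V, ‖a‖ = 1 ∧ ‖e‖ = 1 ∧ ⟪a, e⟫ = 0 ∧ ∀ x y : ℝ, x • a + y • e ∈ R G := by
  have hsub : Φ ⊆ Metric.sphere (0 : V) r := fun x hx => by simpa using hr x hx
  obtain ⟨a, haK, hacc⟩ := hΦ.exists_accPt_of_subset_isCompact (isCompact_sphere _ _) hsub
  have har : ‖a‖ = r := by simpa using haK
  rw [accPt_iff_nhds] at hacc
  have haR : a ∈ R G := by
    have : a ∈ closure (R G) := by
      rw [mem_closure_iff_nhds]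
      intro t ht
      obtain ⟨y, hy, -⟩ := hacc t ht
      exact ⟨y, hy.1, hR hy.2⟩
    rwa [R_closed.closure_eq] at this
  have ha0 : a ≠ 0 := by
    rintro rfl
    obtain ⟨y, hy, hne⟩ := hacc _ univ_mem
    have := hr y hy.2
    rw [← har, norm_zero, norm_eq_zero] at this
    exact hne this
  have hrpos : 0 < r := har ▸ norm_pos_iff.2 ha0
  have hseq : ∀ n : ℕ, ∃ b ∈ Φ, b ≠ a ∧ ‖b - a‖ < min r (1 / ((n : ℝ) + 1)) := by
    intro n
    obtain ⟨y, hy, hne⟩ := hacc (Metric.ball a (min r (1 / ((n : ℝ) + 1))))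
      (Metric.ball_mem_nhds _ (lt_min hrpos (by positivity)))
    exact ⟨y, hy.2, hne, by simpa [dist_eq_norm] using hy.1⟩
  choose b hbΦ hbne hbd using hseq
  have hbt : Tendsto b atTop (nhds a) := by
    rw [tendsto_iff_norm_sub_tendsto_zero]
    exact squeeze_zero (fun _ => norm_nonneg _)
      (fun n => ((hbd n).trans_le (min_le_right _ _)).le) tendsto_one_div_add_atTop_nhds_zero_nat
  have hbr : ∀ n, ‖b n‖ = r := fun n => hr _ (hbΦ n)
  have hb0 : ∀ n, b n ≠ 0 := fun n => norm_pos_iff.1 (by rw [hbr]; exact hrpos)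
  set a' : V := r⁻¹ • a with ha'
  have ha'n : ‖a'‖ = 1 := by
    rw [ha', norm_smul, har, norm_inv, Real.norm_of_nonneg hrpos.le, inv_mul_cancel₀ hrpos.ne']
  have ha'R : a' ∈ R G := R_smul haR _
  have ha'0 : a' ≠ 0 := by intro h; rw [h] at ha'n; simp at ha'n
  set θ : ℕ → ℝ := fun n => angle a' (b n) with hθ
  have hθ' : ∀ n, θ n = angle a (b n) := fun n => by
    rw [hθ]; exact angle_smul_left_of_pos _ _ (inv_pos.2 hrpos)
  have hs : ∀ n, Real.sin (θ n) ≠ 0 := by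
    intro n h
    rw [hθ', sin_eq_zero_iff_angle_eq_zero_or_angle_eq_pi] at h
    rcases h with h | h
    · rw [angle_eq_zero_iff] at h
      obtain ⟨-, c, hc, hbc⟩ := h
      have h1 := hbr n
      rw [hbc, norm_smul, har, Real.norm_of_nonneg hc.le] at h1
      have : c = 1 := by field_simp at h1; exact h1
      apply hbne n
      rw [hbc, this, one_smul]
    · rw [angle_eq_pi_iff] at h
      obtain ⟨-, c, hc, hbc⟩ := h
      have h1 := (hbd n).trans_le (min_le_left _ _)
      have h2 : b n - a = (c - 1) • a := by rw [hbc]; module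
      rw [h2, norm_smul, har, Real.norm_eq_abs, abs_of_neg (by linarith)] at h1
      nlinarith
  have hθt : Tendsto θ atTop (nhds 0) := by
    have h1 : ContinuousAt (fun y : V × V => angle y.1 y.2) (a', a) :=
      continuousAt_angle ha'0 ha0
    have h2 : Tendsto (fun n => (a', b n)) atTop (nhds (a', a)) := tendsto_const_nhds.prodMk_nhds hbt
    have h3 := h1.tendsto.comp h2
    have h4 : angle a' a = 0 := by
      rw [ha', angle_smul_left_of_pos _ _ (inv_pos.2 hrpos), angle_self ha0]
    simp only [h4] at h3
    exact h3
  have hθpos : ∀ n, 0 < θ n := fun n =>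
    lt_of_le_of_ne (angle_nonneg _ _) (fun h => hs n (by rw [← h, Real.sin_zero]))
  have hpol := fun n => polar ha'n (hb0 n) (hs n)
  choose e hen hae hbe using hpol
  obtain ⟨e', he', ψ, hψ, het⟩ := (isCompact_sphere (0 : V) 1).tendsto_subseq (x := e)
    (fun n => by simpa using hen n)
  have he'n : ‖e'‖ = 1 := by simpa using he'
  have hθψ : Tendsto (θ ∘ ψ) atTop (nhds 0) := hθt.comp hψ.tendsto_atTop
  refine ⟨a', e', ha'n, he'n, ?_, ?_⟩
  · have h1 : Tendsto (fun n => ⟪a', (e ∘ ψ) n⟫) atTop (nhds ⟪a', e'⟫) :=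
      tendsto_const_nhds.inner het
    refine tendsto_nhds_unique h1 ?_
    simp only [Function.comp, hae]
    exact tendsto_const_nhds
  · apply plane_of_circ
    intro φ
    have hcR : ∀ n, circ a' (e n) (θ n) ∈ R G := by
      intro n
      have h1 := R_smul (hR (hbΦ n)) r⁻¹
      rw [hbe n, hbr, smul_smul, inv_mul_cancel₀ hrpos.ne', one_smul] at h1
      exact h1
    have hk : Tendsto (fun n => (⌊φ / θ n⌋ : ℝ) * θ n) atTop (nhds φ) := by
      rw [tendsto_iff_norm_sub_tendsto_zero]
      refine squeeze_zero (fun _ => norm_nonneg _) (fun n => ?_) hθt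
      have h1 := Int.floor_le (φ / θ n)
      have h2 := Int.lt_floor_add_one (φ / θ n)
      rw [le_div_iff₀ (hθpos n)] at h1
      rw [div_lt_iff₀ (hθpos n)] at h2
      rw [Real.norm_eq_abs, abs_le]
      constructor <;> linarith
    have hk' := hk.comp hψ.tendsto_atTop
    have hlim : Tendsto (fun n => circ a' (e (ψ n)) ((⌊φ / θ (ψ n)⌋ : ℝ) * θ (ψ n))) atTop
        (nhds (circ a' e' φ)) := by
      unfold circ
      exact (((Real.continuous_cos.tendsto φ).comp hk').smul_const a').add
        (((Real.continuous_sin.tendsto φ).comp hk').smul het)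
    exact R_closed.mem_of_tendsto hlim (Eventually.of_forall fun n =>
      circ_mul_int ha'n (hen _) (hae _) ha'R (hcR _) _)

/-- The group generated by the reflections in the `α j`, `j ∈ J`. -/
noncomputable def GJ {ι : Type*} (α : ι → V) (J : Finset ι) : Subgroup (V ≃ₗᵢ[ℝ] V) :=
  Subgroup.closure ((fun j => sA (α j)) '' (J : Set ι))

section
variable {ι : Type*} {α : ι → V} {J : Finset ι}

lemma sA_mem {j : ι} (hj : j ∈ J) : sA (α j) ∈ GJ α J :=
  Subgroup.subset_closure ⟨j, hj, rfl⟩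

lemma GJ_mono {K : Finset ι} (h : K ⊆ J) : GJ α K ≤ GJ α J :=
  Subgroup.closure_mono (Set.image_mono h)

lemma GJ_fix {g : V ≃ₗᵢ[ℝ] V} (hg : g ∈ GJ α J) {z : V} (hz : ∀ j ∈ J, ⟪z, α j⟫ = 0) :
    g z = z := by
  induction hg using Subgroup.closure_induction with
  | mem x hx =>
    obtain ⟨j, hj, rfl⟩ := hx
    simp only
    rw [sA_apply, reflAt, hz j hj]
    simp
  | one => rfl
  | mul x y _ _ hx hy => rw [LinearIsometryEquiv.coe_mul, Function.comp, hy, hx]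
  | inv x _ hx =>
    have : x⁻¹ (x z) = z := x.symm_apply_apply z
    rwa [hx] at this

lemma alpha_mem_R {j : ι} (hj : j ∈ J) : α j ∈ R (GJ α J) := fun v => by
  rw [← sA_apply]; exact rel_mem (sA_mem hj) v

lemma R_orth {x : V} (hx : x ∈ R (GJ α J)) (hz : ∀ j ∈ J, ⟪x, α j⟫ = 0) : x = 0 := by
  by_contra h0
  have hpos := norm_pos_iff.2 h0
  obtain ⟨g, hg, h⟩ := hx x ‖x‖ hpos
  have hi : ⟪x, x⟫ ≠ 0 := by simpa using h0
  have : reflAt x x = -x := by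
    rw [reflAt, mul_div_assoc, div_self hi]; module
  rw [GJ_fix hg hz, this, sub_neg_eq_add, ← two_smul ℝ, norm_smul] at h
  norm_num at h
  linarith

lemma big [FiniteDimensional ℝ V]
    (hirr : ∀ K ⊆ J, K.Nonempty → (∀ i ∈ K, ∀ j ∈ J, j ∉ K → ⟪α i, α j⟫ = 0) → K = J)
    {j₀ : ι} (hj₀ : j₀ ∈ J) (hinf : {x | ∃ g ∈ GJ α J, g (α j₀) = x}.Infinite) :
    ∃ U : Submodule ℝ V, (U : Set V) ⊆ R (GJ α J) ∧ ∀ j ∈ J, α j ∈ U := by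
  classical
  obtain ⟨a, e, ha, he, hae, hpl⟩ := base (G := GJ α J) hinf
    (by rintro x ⟨g, hg, rfl⟩; exact R_map (alpha_mem_R hj₀) g (rel_mem hg)) (r := ‖α j₀‖)
    (by rintro x ⟨g, hg, rfl⟩; exact g.norm_map _)
  let S : Set (Submodule ℝ V) := {U | (U : Set V) ⊆ R (GJ α J) ∧
    ∃ x ∈ U, ∃ y ∈ U, ‖x‖ = 1 ∧ ‖y‖ = 1 ∧ ⟪x, y⟫ = 0}
  have hS : S.Nonempty := by
    refine ⟨Submodule.span ℝ {a, e}, ?_, a, Submodule.subset_span (by simp), e,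
      Submodule.subset_span (by simp), ha, he, hae⟩
    intro z hz
    obtain ⟨x, y, rfl⟩ := Submodule.mem_span_pair.1 hz
    exact hpl x y
  obtain ⟨U, ⟨hUR, x, hx, y, hy, hxn, hyn, hxy⟩, hmax⟩ :=
    (wellFounded_gt (α := Submodule ℝ V)).has_min S hS
  have horth : ∀ j ∈ J, α j ∉ U → ∀ u ∈ U, ⟪α j, u⟫ = 0 := by
    intro j hj hjU u hu
    by_contra hne
    have hj0 : α j ≠ 0 := fun h => hjU (h ▸ U.zero_mem)
    have hn : ‖α j‖ ≠ 0 := norm_ne_zero_iff.2 hj0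
    set b := ‖α j‖⁻¹ • α j with hb
    have hbn : ‖b‖ = 1 := by rw [hb, norm_smul, norm_inv, norm_norm, inv_mul_cancel₀ hn]
    have hbR : b ∈ R (GJ α J) := R_smul (alpha_mem_R hj) _
    have hbu : ⟪b, u⟫ ≠ 0 := by
      rw [hb, real_inner_smul_left]; exact mul_ne_zero (inv_ne_zero hn) hne
    have hex : ∃ e ∈ U, e ≠ 0 ∧ ⟪b, e⟫ = 0 := by
      by_cases h1 : ⟪b, x⟫ = 0
      · exact ⟨x, hx, fun h => by rw [h] at hxn; simp at hxn, h1⟩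
      · refine ⟨⟪b, y⟫ • x - ⟪b, x⟫ • y, U.sub_mem (U.smul_mem _ hx) (U.smul_mem _ hy), ?_, ?_⟩
        · intro h
          have h2 := congrArg (fun z => ⟪z, y⟫) h
          simp only [inner_sub_left, real_inner_smul_left, hxy, inner_zero_left,
            real_inner_self_eq_norm_sq, hyn] at h2
          apply h1; linarith
        · rw [inner_sub_right, real_inner_smul_right, real_inner_smul_right]; ring
    obtain ⟨e', he'U, he'0, hbe'⟩ := hex
    refine hmax (U ⊔ Submodule.span ℝ {b}) ⟨?_, x, Submodule.mem_sup_left hx, y,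
      Submodule.mem_sup_left hy, hxn, hyn, hxy⟩ ?_
    · intro z hz
      obtain ⟨p, hp, q, hq, rfl⟩ := Submodule.mem_sup.1 hz
      obtain ⟨t, rfl⟩ := Submodule.mem_span_singleton.1 hq
      exact step hUR hbn hbR he'U he'0 hbe' hu hbu hp t
    · refine lt_of_le_of_ne le_sup_left fun h => hjU ?_
      have : b ∈ U := by
        rw [h]; exact Submodule.mem_sup_right (Submodule.mem_span_singleton_self b)
      have h2 := U.smul_mem ‖α j‖ this
      rwa [hb, smul_smul, mul_inv_cancel₀ hn, one_smul] at h2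
  refine ⟨U, hUR, ?_⟩
  have hK := hirr (J.filter fun j => α j ∈ U) (Finset.filter_subset _ _) ?_ ?_
  · intro j hj
    rw [← hK] at hj
    exact (Finset.mem_filter.1 hj).2
  · by_contra hemp
    rw [Finset.not_nonempty_iff_eq_empty, Finset.filter_eq_empty_iff] at hemp
    have : x = 0 := R_orth (hUR hx) fun j hj => by
      rw [real_inner_comm]; exact horth j hj (hemp hj) x hx
    rw [this] at hxn; simp at hxn
  · intro i hi j hj hjK
    rw [Finset.mem_filter] at hi hjK
    rw [real_inner_comm]
    exact horth j hj (fun h => hjK ⟨hj, h⟩) _ hi.2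

lemma move_big [FiniteDimensional ℝ V] {ρ : V} (hρS : ρ ∈ Submodule.span ℝ (α '' J))
    (hρ : ∀ j ∈ J, ⟪ρ, α j⟫ < 0)
    {U : Submodule ℝ V} (hU : (U : Set V) ⊆ R (GJ α J)) (hUα : ∀ j ∈ J, α j ∈ U)
    (v : V) : ∃ g ∈ GJ α J, ∀ j ∈ J, ⟪g v, α j⟫ ≤ 0 := by
  classical
  set S := Submodule.span ℝ (α '' (J : Set ι)) with hS
  have hSU : S ≤ U := by
    rw [hS, Submodule.span_le]; rintro _ ⟨j, hj, rfl⟩; exact hUα j hj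
  have hαS : ∀ j ∈ J, α j ∈ S := fun j hj => Submodule.subset_span ⟨j, hj, rfl⟩
  set p := S.starProjection v with hp
  have hpS : p ∈ S := Submodule.starProjection_apply_mem _ _
  have hperp : ∀ w ∈ S, ⟪v - p, w⟫ = 0 := fun w hw => Submodule.starProjection_inner_eq_zero v w hw
  have hvp : v = (v - p) + p := by abel
  by_cases hp0 : p = 0
  · refine ⟨1, Subgroup.one_mem _, fun j hj => ?_⟩
    have := hperp _ (hαS j hj)
    rw [hp0, sub_zero] at this
    exact this.le
  rcases J.eq_empty_or_nonempty with hJ | ⟨j₀, hj₀⟩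
  · exact ⟨1, Subgroup.one_mem _, fun j hj => by simp [hJ] at hj⟩
  have hρ0 : ρ ≠ 0 := by
    intro h; have := hρ j₀ hj₀; rw [h, inner_zero_left] at this; exact lt_irrefl _ this
  have hρn := norm_pos_iff.2 hρ0
  have hpn := norm_pos_iff.2 hp0
  set t := ‖p‖ / ‖ρ‖ with ht
  have htpos : 0 < t := div_pos hpn hρn
  set y := (v - p) + t • ρ with hy
  have hyα : ∀ j ∈ J, ⟪y, α j⟫ < 0 := by
    intro j hj
    rw [hy, inner_add_left, hperp _ (hαS j hj), real_inner_smul_left, zero_add]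
    exact mul_neg_of_pos_of_neg htpos (hρ j hj)
  have hrel : Rel (GJ α J) v y := by
    by_cases hvy : v - y = 0
    · rw [← sub_eq_zero.1 hvy]; exact rel_refl v
    have hd : v - y = p - t • ρ := by rw [hy]; abel
    have hmem : v - y ∈ S := by
      rw [hd]; exact S.sub_mem hpS (S.smul_mem _ hρS)
    have h1 := hU (hSU hmem) v
    convert h1 using 1
    have hi : ⟪v - y, v - y⟫ ≠ 0 := by simpa using hvy
    have h2 : 2 * ⟪v, v - y⟫ = ⟪v - y, v - y⟫ := by
      have h3 : ⟪v, v - y⟫ = ⟪p, v - y⟫ := by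
        have := hperp _ hmem
        rw [inner_sub_left] at this; linarith
      have h4 : t ^ 2 * ‖ρ‖ ^ 2 = ‖p‖ ^ 2 := by rw [ht]; field_simp
      have h5 : ‖t • ρ‖ ^ 2 = t ^ 2 * ‖ρ‖ ^ 2 := by
        rw [norm_smul, mul_pow, Real.norm_eq_abs, sq_abs]
      rw [h3, hd]
      simp only [inner_sub_left, inner_sub_right, real_inner_smul_left, real_inner_smul_right,
        real_inner_self_eq_norm_sq, real_inner_comm ρ p]
      linarith
    rw [reflAt, h2, div_self hi, one_smul]; abel
  have hopen : IsOpen {z : V | ∀ j ∈ J, ⟪z, α j⟫ < 0} := by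
    have : {z : V | ∀ j ∈ J, ⟪z, α j⟫ < 0} = ⋂ j ∈ J, {z : V | ⟪z, α j⟫ < 0} := by ext; simp
    rw [this]
    exact isOpen_biInter_finset fun j _ => isOpen_lt (by fun_prop) continuous_const
  obtain ⟨ε, hε, hball⟩ := Metric.isOpen_iff.1 hopen y hyα
  obtain ⟨g, hg, hgv⟩ := hrel ε hε
  have := hball (show g v ∈ Metric.ball y ε by simpa [dist_eq_norm] using hgv)
  exact ⟨g, hg, fun j hj => (this j hj).le⟩

lemma move_fin {ρ : V} (hρS : ρ ∈ Submodule.span ℝ (α '' J))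
    (hα : ∀ j ∈ J, α j ≠ 0) (hρ : ∀ j ∈ J, ⟪ρ, α j⟫ < 0)
    (hfin : ∀ j ∈ J, {x | ∃ g ∈ GJ α J, g (α j) = x}.Finite)
    (v : V) : ∃ g ∈ GJ α J, ∀ j ∈ J, ⟪g v, α j⟫ ≤ 0 := by
  have horb : {x | ∃ g ∈ GJ α J, g ρ = x}.Finite := by
    clear hρ
    induction hρS using Submodule.span_induction with
    | mem x hx => obtain ⟨j, hj, rfl⟩ := hx; exact hfin j hj
    | zero => exact (Set.finite_singleton (0 : V)).subset (by rintro _ ⟨g, _, rfl⟩; simp)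
    | add x y _ _ hx hy =>
      refine (hx.image2 (fun a b => a + b) hy).subset ?_
      rintro _ ⟨g, hg, rfl⟩
      exact ⟨g x, ⟨g, hg, rfl⟩, g y, ⟨g, hg, rfl⟩, (map_add g x y).symm⟩
    | smul c x _ hx =>
      refine (hx.image (fun a => c • a)).subset ?_
      rintro _ ⟨g, hg, rfl⟩
      exact ⟨g x, ⟨g, hg, rfl⟩, (map_smul g c x).symm⟩
  have hvals : {c : ℝ | ∃ g ∈ GJ α J, ⟪g v, ρ⟫ = c}.Finite := by
    refine (horb.image fun x => ⟪v, x⟫).subset ?_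
    rintro _ ⟨g, hg, rfl⟩
    exact ⟨g⁻¹ ρ, ⟨g⁻¹, Subgroup.inv_mem _ hg, rfl⟩, (inner_inv g v ρ).symm⟩
  obtain ⟨c, ⟨g, hg, rfl⟩, hmax⟩ := Set.exists_max_image _ id hvals ⟨_, 1, Subgroup.one_mem _, rfl⟩
  refine ⟨g, hg, fun j hj => ?_⟩
  by_contra! hpos
  have h1 := hmax _ ⟨sA (α j) * g, Subgroup.mul_mem _ (sA_mem hj) hg, rfl⟩
  simp only [id, LinearIsometryEquiv.coe_mul, Function.comp, sA_apply, reflAt] at h1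
  rw [inner_sub_left, real_inner_smul_left] at h1
  have h2 : 0 < ⟪α j, α j⟫ := real_inner_self_pos.2 (hα j hj)
  have h3 : 0 < 2 * ⟪g v, α j⟫ / ⟪α j, α j⟫ := by positivity
  have h4 : ⟪α j, ρ⟫ < 0 := by rw [real_inner_comm]; exact hρ j hj
  nlinarith

lemma move [FiniteDimensional ℝ V] {η : V} (hα : ∀ j, α j ≠ 0) (hη : ∀ j, ⟪η, α j⟫ < 0)
    (J : Finset ι) : ∀ v : V, ∃ g ∈ GJ α J, ∀ j ∈ J, ⟪g v, α j⟫ ≤ 0 := by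
  classical
  induction J using Finset.strongInduction with
  | H J ih =>
  intro v
  by_cases hirr : ∀ K ⊆ J, K.Nonempty → (∀ i ∈ K, ∀ j ∈ J, j ∉ K → ⟪α i, α j⟫ = 0) → K = J
  · set ρ := (Submodule.span ℝ (α '' (J : Set ι))).starProjection η with hρd
    have hρS : ρ ∈ Submodule.span ℝ (α '' (J : Set ι)) := Submodule.starProjection_apply_mem _ _
    have hρ : ∀ j ∈ J, ⟪ρ, α j⟫ < 0 := by
      intro j hj
      have := Submodule.starProjection_inner_eq_zero
        (K := Submodule.span ℝ (α '' (J : Set ι))) η (α j) (Submodule.subset_span ⟨j, hj, rfl⟩)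
      rw [inner_sub_left] at this
      have := hη j
      linarith
    by_cases hfin : ∀ j ∈ J, {x | ∃ g ∈ GJ α J, g (α j) = x}.Finite
    · exact move_fin hρS (fun j _ => hα j) hρ hfin v
    · push Not at hfin
      obtain ⟨j₀, hj₀, hinf⟩ := hfin
      obtain ⟨U, hU, hUα⟩ := big hirr hj₀ hinf
      exact move_big hρS hρ hU hUα v
  · push Not at hirr
    obtain ⟨K, hKJ, ⟨k, hk⟩, horth, hne⟩ := hirr
    obtain ⟨g₂, hg₂, h₂⟩ := ih (J \ K) (Finset.sdiff_ssubset hKJ ⟨k, hk⟩) v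
    obtain ⟨g₁, hg₁, h₁⟩ := ih K (lt_of_le_of_ne hKJ hne) (g₂ v)
    refine ⟨g₁ * g₂, Subgroup.mul_mem _ (GJ_mono hKJ hg₁) (GJ_mono Finset.sdiff_subset hg₂), ?_⟩
    intro j hj
    rw [LinearIsometryEquiv.coe_mul, Function.comp]
    by_cases hjK : j ∈ K
    · exact h₁ j hjK
    · rw [inner_inv, GJ_fix (Subgroup.inv_mem _ hg₁)
        (fun i hi => by rw [real_inner_comm]; exact horth i hi j hj hjK)]
      exact h₂ j (Finset.mem_sdiff.2 ⟨hj, hjK⟩)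

end

end WeylAux

/-- an anti-dominant weight `λ` lies in the topological interior of
`σ_λ = ⋃_{w ∈ W_λ} w·C`. -/
theorem statement2 {n : ℕ} {V : Type*} [NormedAddCommGroup V] [InnerProductSpace ℝ V]
    [FiniteDimensional ℝ V] (B : RootSystemBase n V) (W : Subgroup (V ≃ₗ[ℝ] V))
    (hW : B.IsWeylGroup W) (l : V) (hl : l ∈ B.C) :
    l ∈ interior (B.sigmaCone W l) := by
  classical
  have hself : ∀ j, 0 < ⟪B.α j, B.α j⟫ := fun j => real_inner_self_pos.2 (B.α_ne j)
  have hη : ∀ j, ⟪-∑ i, B.ω i, B.α j⟫ < 0 := by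
    intro j
    have h1 : ∀ i, ⟪B.ω i, B.α j⟫ = if i = j then ⟪B.α j, B.α j⟫ / 2 else 0 := by
      intro i
      have h := B.dual i j
      rw [div_eq_iff (hself j).ne'] at h
      split_ifs with hij
      · rw [if_pos hij] at h; linarith
      · rw [if_neg hij] at h; linarith
    rw [inner_neg_left, sum_inner]
    simp only [h1, Finset.sum_ite_eq', Finset.mem_univ, if_true]
    have := hself j
    linarith
  set J : Finset (Fin n) := Finset.univ.filter fun i => ⟪l, B.α i⟫ = 0 with hJ
  have hopen : IsOpen {z : V | ∀ i, i ∉ J → ⟪z, B.α i⟫ < 0} := by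
    have : {z : V | ∀ i, i ∉ J → ⟪z, B.α i⟫ < 0} =
        ⋂ i : Fin n, ⋂ _ : i ∉ J, {z : V | ⟪z, B.α i⟫ < 0} := by ext; simp
    rw [this]
    exact isOpen_iInter_of_finite fun i => isOpen_iInter_of_finite fun _ =>
      isOpen_lt (by fun_prop) continuous_const
  have hlmem : l ∈ {z : V | ∀ i, i ∉ J → ⟪z, B.α i⟫ < 0} := by
    intro i hi
    refine lt_of_le_of_ne (hl i) fun h => hi ?_
    rw [hJ, Finset.mem_filter]
    exact ⟨Finset.mem_univ _, h⟩
  obtain ⟨ε, hε, hball⟩ := Metric.isOpen_iff.1 hopen l hlmem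
  rw [mem_interior]
  refine ⟨Metric.ball l ε, ?_, Metric.isOpen_ball, Metric.mem_ball_self hε⟩
  intro v hv
  have hGW : ∀ g ∈ WeylAux.GJ B.α J, g.toLinearEquiv ∈ W := by
    intro g hg
    induction hg using Subgroup.closure_induction with
    | mem x hx =>
      obtain ⟨j, hj, rfl⟩ := hx
      rw [hW]
      exact Subgroup.subset_closure ⟨j, fun v => WeylAux.sA_apply _ v⟩
    | one => exact W.one_mem
    | mul x y _ _ hx hy => exact W.mul_mem hx hy
    | inv x _ hx => exact W.inv_mem hx
  obtain ⟨g, hg, hgv⟩ := WeylAux.move B.α_ne hη J v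
  have hfix : ∀ g ∈ WeylAux.GJ B.α J, g l = l := fun g hg =>
    WeylAux.GJ_fix hg fun j hj => (Finset.mem_filter.1 hj).2
  have hg' := Subgroup.inv_mem _ hg
  rw [RootSystemBase.sigmaCone, Set.mem_iUnion₂]
  refine ⟨(g⁻¹).toLinearEquiv, ⟨hGW _ hg', hfix _ hg'⟩, g v, ?_, g.symm_apply_apply v⟩
  intro i
  by_cases hi : i ∈ J
  · exact hgv i hi
  · refine (hball (?_ : g v ∈ Metric.ball l ε) i hi).le
    rw [Metric.mem_ball, dist_eq_norm] at hv ⊢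
    have : g v - l = g (v - l) := by rw [map_sub, hfix g hg]
    rw [this, g.norm_map]
    exact hv
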